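/- Let d be a positive integer and let c : ℝ^d → ℂ be an integral ℝ^d-configuration (finite range, all values integers) whose support is a Delone set of finite local complexity. Assume that for every (d−1)-dimensional linear subspace V of ℝ^d there exists a non-trivial ℝ^d-polynomial f that annihilates c and satisfies supp(f) ∩ V = {0}. Then c is strongly periodic, i.e., c has d period vectors linearly independent over ℝ. -/

import Mathlib

/- STATEMENT 5: Forced periodicity of integral Delone configurations of finite
   local complexity whose annihilators avoid every (d−1)-dimensional subspace
   except at the origin. -/

open scoped Pointwise

noncomputable section

abbrev Euc (d : ℕ) := EuclideanSpace ℝ (Fin d)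

def conv {d : ℕ} (f c : Euc d → ℂ) (u : Euc d) : ℂ := ∑ᶠ v, f v * c (u - v)

def Annihilates {d : ℕ} (f c : Euc d → ℂ) : Prop := ∀ u, conv f c u = 0

def UniformlyDiscrete {d : ℕ} (S : Set (Euc d)) : Prop :=
  ∃ r > (0:ℝ), ∀ x : Euc d, (S ∩ Metric.ball x r).Subsingleton

def RelativelyDense {d : ℕ} (S : Set (Euc d)) : Prop :=
  ∃ R > (0:ℝ), ∀ x : Euc d, (S ∩ Metric.closedBall x R).Nonempty

def IsDelone {d : ℕ} (S : Set (Euc d)) : Prop := UniformlyDiscrete S ∧ RelativelyDense S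

def SetLocallyFinite {d : ℕ} (S : Set (Euc d)) : Prop :=
  ∀ B : Set (Euc d), Bornology.IsBounded B → (S ∩ B).Finite

def DeloneFLC {d : ℕ} (S : Set (Euc d)) : Prop := IsDelone S ∧ SetLocallyFinite (S - S)

def StronglyPeriodic {d : ℕ} (c : Euc d → ℂ) : Prop :=
  ∃ t : Fin d → Euc d, LinearIndependent ℝ t ∧ ∀ i, ∀ u, c (u - t i) = c u


section Alg
variable {G : Type*} [AddCommGroup G]

/-- the shift action of the group ring on functions -/
def act (R : Type*) [CommRing R] (G : Type*) [AddCommGroup G] :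
    AddMonoidAlgebra R G →ₐ[R] Module.End R (G → R) :=
  AddMonoidAlgebra.lift R (Module.End R (G → R)) G
    { toFun := fun v => LinearMap.funLeft R R (fun u => u - v.toAdd)
      map_one' := by ext; simp [LinearMap.funLeft]
      map_mul' := by
        intro a b
        refine LinearMap.ext fun x => funext fun u => ?_
        simp [LinearMap.funLeft, sub_sub] }

lemma act_single {R : Type*} [CommRing R] (v : G) (r : R) (m : G → R) (u : G) :
    act R G (AddMonoidAlgebra.single v r) m u = r * m (u - v) := by
  simp [act, AddMonoidAlgebra.lift_single, LinearMap.funLeft]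

lemma act_sum {R : Type*} [CommRing R] {ι : Type*} (S : Finset ι) (g : ι → G) (r : ι → R)
    (m : G → R) (u : G) :
    act R G (∑ i ∈ S, AddMonoidAlgebra.single (g i) (r i)) m u = ∑ i ∈ S, r i * m (u - g i) := by
  rw [map_sum, LinearMap.sum_apply, Finset.sum_apply]
  simp only [act_single]

lemma dvd_dilate (p : ℕ) [hp : Fact p.Prime] (S : Finset G) (q : G → ℤ) (g : G → G) (m : G → ℤ)
    (h : ∀ u, ∑ v ∈ S, q v * m (u - g v) = 0) (u : G) :
    (p : ℤ) ∣ ∑ v ∈ S, q v * m (u - p • g v) := by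
  rw [← ZMod.intCast_zmod_eq_zero_iff_dvd]
  have : CharP (AddMonoidAlgebra (ZMod p) G) p :=
    charP_of_injective_algebraMap (algebraMap (ZMod p) _).injective p
  set M : G → ZMod p := fun u => (m u : ZMod p) with hM
  have h0 : act (ZMod p) G (∑ v ∈ S, AddMonoidAlgebra.single (g v) (q v : ZMod p)) M = 0 := by
    funext u
    rw [act_sum]
    have := congrArg (Int.cast : ℤ → ZMod p) (h u)
    push_cast at this
    simpa [hM] using this
  have h1 : act (ZMod p) G ((∑ v ∈ S, AddMonoidAlgebra.single (g v) (q v : ZMod p)) ^ p) M = 0 := by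
    rw [← pow_sub_one_mul hp.out.ne_zero, map_mul, Module.End.mul_apply, h0, map_zero]
  rw [sum_pow_char] at h1
  simp only [AddMonoidAlgebra.single_pow, ZMod.pow_card] at h1
  have h2 := congrFun h1 u
  rw [act_sum] at h2
  push_cast
  simpa [hM] using h2

lemma dilate_prime (p : ℕ) (hp : p.Prime) (S : Finset G) (q : G → ℤ) (g : G → G) (m : G → ℤ)
    (K : ℤ) (hK : ∀ u, |m u| ≤ K) (hpK : (∑ v ∈ S, |q v|) * K < p)
    (h : ∀ u, ∑ v ∈ S, q v * m (u - g v) = 0) (u : G) :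
    ∑ v ∈ S, q v * m (u - p • g v) = 0 := by
  have : Fact p.Prime := ⟨hp⟩
  refine Int.eq_zero_of_abs_lt_dvd (dvd_dilate p S q g m h u) (lt_of_le_of_lt ?_ hpK)
  refine (Finset.abs_sum_le_sum_abs _ _).trans ?_
  rw [Finset.sum_mul]
  refine Finset.sum_le_sum fun v _ => ?_
  rw [abs_mul]
  exact mul_le_mul_of_nonneg_left (hK _) (abs_nonneg _)

lemma dilate (S : Finset G) (q : G → ℤ) (m : G → ℤ)
    (K : ℤ) (hK : ∀ u, |m u| ≤ K)
    (h : ∀ u, ∑ v ∈ S, q v * m (u - v) = 0) (k : ℕ) (hk0 : k ≠ 0)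
    (hk : ∀ p : ℕ, p.Prime → p ∣ k → (∑ v ∈ S, |q v|) * K < p) :
    ∀ u, ∑ v ∈ S, q v * m (u - k • v) = 0 := by
  induction k using Nat.recOnPrimePow with
  | zero => exact absurd rfl hk0
  | one => simpa using h
  | prime_pow_mul a p n hp hpa hn ih =>
    have ha : a ≠ 0 := by rintro rfl; simp at hpa
    have iha := ih ha (fun p' hp' hd => hk p' hp' (hd.mul_left _))
    have hpK := hk p hp ((dvd_pow_self p hn.ne').mul_right _)
    clear ih hk hk0 hn
    induction n with
    | zero => simpa using iha
    | succ n ihn =>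
      intro u
      have := dilate_prime p hp S q (fun v => (p ^ n * a) • v) m K hK hpK ihn u
      simp only [smul_smul] at this
      rw [pow_succ', mul_assoc]
      exact this

open Polynomial in
lemma prod_annih (S : Finset G) (q : G → ℤ) (h0S : (0 : G) ∈ S) (h0 : q 0 ≠ 0) (m : G → ℤ)
    (K : ℤ) (hK : ∀ u, |m u| ≤ K)
    (h : ∀ u, ∑ v ∈ S, q v * m (u - v) = 0) :
    ∃ M : ℕ, 0 < M ∧ ∀ S' : Finset G, (∀ v ∈ S, v ≠ 0 → v ∈ S') →
      act ℤ G (∏ v ∈ S', (1 - AddMonoidAlgebra.single (M • v) 1)) m = 0 := by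
  classical
  obtain ⟨B, hB⟩ : ∃ B : ℕ, (∑ v ∈ S, |q v|) * K ≤ B := ⟨_, Int.self_le_toNat _⟩
  refine ⟨B.factorial, Nat.factorial_pos B, ?_⟩
  set M := B.factorial with hM
  intro S' hSS'
  have key : ∀ j : ℕ, act ℤ G (∑ v ∈ S, AddMonoidAlgebra.single v (q v) *
      (AddMonoidAlgebra.single (M • v) 1) ^ j) m = 0 := by
    intro j
    funext u
    simp only [AddMonoidAlgebra.single_pow, AddMonoidAlgebra.single_mul_single, one_pow, mul_one]
    rw [act_sum]
    have := dilate S q m K hK h (1 + j * M) (by omega) ?_ u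
    · simpa [add_smul, smul_smul] using this
    · intro p hp hpd
      by_contra hcon
      have hpB : p ≤ B := by
        have : (p : ℤ) ≤ B := by linarith
        exact_mod_cast this
      have h1 : p ∣ M := hp.dvd_factorial.2 hpB
      have h2 : p ∣ 1 := (Nat.dvd_add_left (h1.mul_left j)).1 hpd
      exact hp.one_lt.ne' (Nat.dvd_one.1 h2)
  have keyP : ∀ P : (AddMonoidAlgebra ℤ G)[X], act ℤ G (∑ v ∈ S, AddMonoidAlgebra.single v (q v) *
      P.eval (AddMonoidAlgebra.single (M • v) 1)) m = 0 := by
    intro P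
    have : ∑ v ∈ S, AddMonoidAlgebra.single v (q v) * P.eval (AddMonoidAlgebra.single (M • v) 1)
      = ∑ j ∈ Finset.range (P.natDegree + 1), P.coeff j * ∑ v ∈ S, AddMonoidAlgebra.single v (q v) *
      (AddMonoidAlgebra.single (M • v) 1) ^ j := by
      simp only [Polynomial.eval_eq_sum_range, Finset.mul_sum]
      rw [Finset.sum_comm]
      refine Finset.sum_congr rfl fun _ _ => Finset.sum_congr rfl fun _ _ => by ring
    rw [this, map_sum, LinearMap.sum_apply]
    refine Finset.sum_eq_zero fun j _ => ?_
    rw [map_mul, Module.End.mul_apply, key, map_zero]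
  have := keyP (∏ v ∈ S', (X - C (AddMonoidAlgebra.single (M • v) 1)))
  simp only [Polynomial.eval_prod, eval_sub, eval_X, eval_C] at this
  rw [Finset.sum_eq_single_of_mem 0 h0S] at this
  · rw [map_mul, Module.End.mul_apply] at this
    funext u
    have h3 := congrFun this u
    rw [act_single] at h3
    simpa [h0, AddMonoidAlgebra.one_def] using h3
  · intro v hv hv0
    have : v ∈ S' := hSS' v hv hv0
    rw [Finset.prod_eq_zero this (sub_self _), mul_zero]

lemma act_injective_of_unit (a b : AddMonoidAlgebra ℤ G) (ha : IsUnit a) (m : G → ℤ)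
    (h : act ℤ G (a * b) m = 0) : act ℤ G b m = 0 := by
  obtain ⟨c, hc⟩ := ha.exists_left_inv
  have : act ℤ G (c * (a * b)) m = 0 := by
    rw [map_mul, Module.End.mul_apply, h, map_zero]
  rwa [← mul_assoc, hc, one_mul] at this

lemma det_of_annih (S : Finset G) (l : G →+ ℝ) (hl : ∀ v ∈ S, l v ≠ 0) (m : G → ℤ)
    (h : act ℤ G (∏ v ∈ S, (1 - AddMonoidAlgebra.single v 1)) m = 0) :
    ∃ W : Finset G, (∀ w ∈ W, 0 < l w) ∧
      ∀ x y, (∀ w ∈ W, m (x - w) = m (y - w)) → m x = m y := by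
  classical
  set s : G → G := fun v => if 0 < l v then v else - v with hs
  have hspos : ∀ v ∈ S, 0 < l (s v) := by
    intro v hv
    simp only [hs]
    split_ifs with h1
    · exact h1
    · rw [map_neg]
      have := lt_of_le_of_ne (not_lt.1 h1) (hl v hv)
      linarith
  have hU : ∀ v : G, ∃ U : AddMonoidAlgebra ℤ G, IsUnit U ∧
      1 - AddMonoidAlgebra.single v 1 = U * (1 + AddMonoidAlgebra.single (s v) (-1)) := by
    intro v
    simp only [hs]
    split_ifs with h1
    · refine ⟨1, isUnit_one, ?_⟩
      rw [one_mul, AddMonoidAlgebra.single_neg, sub_eq_add_neg]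
    · refine ⟨AddMonoidAlgebra.single v (-1), ?_, ?_⟩
      · refine IsUnit.of_mul_eq_one (AddMonoidAlgebra.single (-v) (-1)) ?_
        rw [AddMonoidAlgebra.single_mul_single, AddMonoidAlgebra.one_def]
        simp
      · rw [mul_add, AddMonoidAlgebra.single_mul_single]
        simp only [AddMonoidAlgebra.one_def, AddMonoidAlgebra.single_neg]
        simp [← AddMonoidAlgebra.one_def]
        abel
  choose U hU1 hU2 using hU
  have h1 : act ℤ G (∏ v ∈ S, (1 + AddMonoidAlgebra.single (s v) (-1))) m = 0 := by
    refine act_injective_of_unit (∏ v ∈ S, U v) _ ?_ m ?_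
    · exact Finset.prod_induction _ IsUnit (fun _ _ => IsUnit.mul) isUnit_one (fun v _ => hU1 v)
    · rw [← Finset.prod_mul_distrib]
      simpa only [← hU2] using h
  have hps : ∀ t : Finset G, ∏ v ∈ t, (AddMonoidAlgebra.single (s v) (-1) : AddMonoidAlgebra ℤ G)
      = AddMonoidAlgebra.single (∑ v ∈ t, s v) ((-1) ^ t.card) := by
    intro t
    induction t using Finset.induction_on with
    | empty => simp [AddMonoidAlgebra.one_def]
    | insert a t ha ih =>
      rw [Finset.prod_insert ha, Finset.sum_insert ha, ih, AddMonoidAlgebra.single_mul_single,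
        Finset.card_insert_of_notMem ha, pow_succ']
  rw [Finset.prod_one_add] at h1
  simp only [hps] at h1
  have h2 : ∀ u, m u = - ∑ t ∈ S.powerset.erase ∅, (-1) ^ t.card * m (u - ∑ v ∈ t, s v) := by
    intro u
    have := congrFun h1 u
    rw [act_sum, ← Finset.add_sum_erase _ _ (Finset.empty_mem_powerset S)] at this
    simp only [Finset.card_empty, Finset.sum_empty, pow_zero, one_mul, sub_zero,
      Pi.zero_apply] at this
    linarith
  refine ⟨(S.powerset.erase ∅).image (fun t => ∑ v ∈ t, s v), ?_, ?_⟩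
  · intro w hw
    obtain ⟨t, ht, rfl⟩ := Finset.mem_image.1 hw
    rw [Finset.mem_erase, Finset.mem_powerset] at ht
    rw [map_sum]
    exact Finset.sum_pos (fun v hv => hspos v (ht.2 hv)) (Finset.nonempty_iff_ne_empty.2 ht.1)
  · intro x y hxy
    rw [h2 x, h2 y]
    congr 1
    refine Finset.sum_congr rfl fun t ht => ?_
    rw [hxy _ (Finset.mem_image_of_mem _ ht)]

end Alg

lemma int_annih {G : Type*} [AddCommGroup G] (S : Finset G) (f : G → ℂ) (h0S : (0 : G) ∈ S)
    (h0 : f 0 ≠ 0) (m : G → ℤ) (h : ∀ u, ∑ v ∈ S, f v * (m (u - v) : ℂ) = 0) :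
    ∃ q : G → ℤ, q 0 ≠ 0 ∧ ∀ u, ∑ v ∈ S, q v * m (u - v) = 0 := by
  classical
  obtain ⟨φ, hφ⟩ : ∃ φ : Module.Dual ℚ ℂ, φ (f 0) ≠ 0 := by
    by_contra hcon
    push Not at hcon
    exact h0 ((Module.forall_dual_apply_eq_zero_iff ℚ (f 0)).1 hcon)
  have h1 : ∀ u, ∑ v ∈ S, φ (f v) * (m (u - v) : ℚ) = 0 := by
    intro u
    have := congrArg φ (h u)
    rw [map_sum, map_zero] at this
    rw [← this]
    refine Finset.sum_congr rfl fun v _ => ?_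
    rw [mul_comm (f v), ← zsmul_eq_mul, map_zsmul, zsmul_eq_mul, mul_comm]
  obtain ⟨b, hb⟩ := IsLocalization.exist_integer_multiples_of_finset (nonZeroDivisors ℤ)
    (S.image fun v => φ (f v))
  have hb' : ∀ v ∈ S, ∃ z : ℤ, (z : ℚ) = (b : ℤ) * φ (f v) := by
    intro v hv
    obtain ⟨z, hz⟩ := hb _ (Finset.mem_image_of_mem _ hv)
    exact ⟨z, by simpa using hz⟩
  have hb0 : ((b : ℤ) : ℚ) ≠ 0 := by exact_mod_cast nonZeroDivisors.coe_ne_zero b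
  choose! q hq using hb'
  refine ⟨q, ?_, ?_⟩
  · intro hq0
    have := hq 0 h0S
    rw [hq0] at this
    simp [hφ] at this
  · intro u
    have : ((∑ v ∈ S, q v * m (u - v) : ℤ) : ℚ) = 0 := by
      push_cast
      rw [← mul_zero ((b : ℤ) : ℚ), ← h1 u, Finset.mul_sum]
      refine Finset.sum_congr rfl fun v hv => ?_
      rw [hq v hv, mul_assoc]
    exact_mod_cast this

lemma det_dir {d : ℕ} (m : Euc d → ℤ) (K : ℤ) (hK : ∀ u, |m u| ≤ K) (n : Euc d)
    (f : Euc d → ℂ) (hf : (Function.support f).Finite)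
    (ha : Annihilates f (fun u => (m u : ℂ)))
    (hs : Function.support f ∩ {x | inner ℝ x n = 0} = {0}) :
    ∃ W : Finset (Euc d), (∀ w ∈ W, 0 < inner ℝ w n) ∧
      ∀ x y, (∀ w ∈ W, m (x - w) = m (y - w)) → m x = m y := by
  classical
  have h0 : f 0 ≠ 0 := by
    have : (0 : Euc d) ∈ Function.support f ∩ {x | inner ℝ x n = 0} := by rw [hs]; rfl
    exact this.1
  have h0S : (0 : Euc d) ∈ hf.toFinset := by simpa using h0
  obtain ⟨q, hq0, hq⟩ := int_annih hf.toFinset f h0S h0 m (by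
    intro u
    have := ha u
    unfold conv at this
    rw [finsum_eq_sum_of_support_subset] at this
    · exact this
    · intro v hv
      simp only [Function.mem_support] at hv
      simpa using left_ne_zero_of_mul hv)
  obtain ⟨M, hM, hM'⟩ := prod_annih hf.toFinset q h0S hq0 m K hK hq
  have hinj : Function.Injective (fun v : Euc d => M • v) := fun a b hab => by
    have hM0 : (M : ℝ) ≠ 0 := by exact_mod_cast hM.ne'
    simp only [← Nat.cast_smul_eq_nsmul ℝ] at hab
    exact smul_right_injective _ hM0 hab
  have := hM' (hf.toFinset.erase 0) (fun v hv hv0 => Finset.mem_erase.2 ⟨hv0, hv⟩)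
  refine det_of_annih ((hf.toFinset.erase 0).image (fun v => M • v))
    ((innerₗ (Euc d)).flip n).toAddMonoidHom ?_ m ?_
  · intro w hw
    obtain ⟨v, hv, rfl⟩ := Finset.mem_image.1 hw
    rw [Finset.mem_erase] at hv
    intro h1
    have h2 : inner ℝ (M • v) n = 0 := h1
    rw [← Nat.cast_smul_eq_nsmul ℝ, real_inner_smul_left] at h2
    have h3 : inner ℝ v n = 0 := by
      rcases mul_eq_zero.1 h2 with h | h
      · exact absurd h (by exact_mod_cast hM.ne')
      · exact h
    have : v ∈ Function.support f ∩ {x | inner ℝ x n = 0} := ⟨by simpa using hv.2, h3⟩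
    rw [hs] at this
    exact hv.1 this
  · rw [Finset.prod_image (fun a _ b _ hab => hinj hab)]
    exact this

lemma unif_det {d : ℕ} (m : Euc d → ℤ)
    (h : ∀ n : Euc d, n ≠ 0 → ∃ W : Finset (Euc d), (∀ w ∈ W, 0 < inner ℝ w n) ∧
      ∀ x y, (∀ w ∈ W, m (x - w) = m (y - w)) → m x = m y) :
    ∃ ε > (0:ℝ), ∃ L ≥ (0:ℝ), ∀ n ∈ Metric.sphere (0 : Euc d) 1, ∃ W : Finset (Euc d),
      (∀ w ∈ W, ε ≤ inner ℝ w n ∧ ‖w‖ ≤ L) ∧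
      ∀ x y, (∀ w ∈ W, m (x - w) = m (y - w)) → m x = m y := by
  refine (isCompact_sphere (0 : Euc d) 1).induction_on (p := fun s => ∃ ε > (0:ℝ), ∃ L ≥ (0:ℝ),
    ∀ n ∈ s, ∃ W : Finset (Euc d), (∀ w ∈ W, ε ≤ inner ℝ w n ∧ ‖w‖ ≤ L) ∧
      ∀ x y, (∀ w ∈ W, m (x - w) = m (y - w)) → m x = m y) ?_ ?_ ?_ ?_
  · exact ⟨1, one_pos, 0, le_rfl, by simp⟩
  · rintro s t hst ⟨ε, hε, L, hL, H⟩
    exact ⟨ε, hε, L, hL, fun n hn => H n (hst hn)⟩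
  · rintro s t ⟨ε, hε, L, hL, H⟩ ⟨ε', hε', L', hL', H'⟩
    refine ⟨min ε ε', lt_min hε hε', max L L', le_max_of_le_left hL, ?_⟩
    rintro n (hn | hn)
    · obtain ⟨W, hW, hd⟩ := H n hn
      exact ⟨W, fun w hw => ⟨(min_le_left _ _).trans (hW w hw).1,
        (hW w hw).2.trans (le_max_left _ _)⟩, hd⟩
    · obtain ⟨W, hW, hd⟩ := H' n hn
      exact ⟨W, fun w hw => ⟨(min_le_right _ _).trans (hW w hw).1,
        (hW w hw).2.trans (le_max_right _ _)⟩, hd⟩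
  · intro n hn
    have hn0 : n ≠ 0 := by
      rintro rfl
      simp at hn
    obtain ⟨W, hW, hd⟩ := h n hn0
    obtain ⟨ε, hε, hεW⟩ : ∃ ε > (0:ℝ), ∀ w ∈ W, ε < inner ℝ w n := by
      rcases W.eq_empty_or_nonempty with rfl | hne
      · exact ⟨1, one_pos, by simp⟩
      · obtain ⟨w0, hw0, hmin⟩ := W.exists_min_image (fun w => inner ℝ w n) hne
        refine ⟨inner ℝ w0 n / 2, half_pos (hW w0 hw0), fun w hw => ?_⟩
        have := hmin w hw
        have := hW w0 hw0
        linarith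
    refine ⟨{x | ∀ w ∈ W, ε < inner ℝ w x}, mem_nhdsWithin_of_mem_nhds ?_, ε, hε,
      ∑ w ∈ W, ‖w‖, Finset.sum_nonneg fun _ _ => norm_nonneg _, ?_⟩
    · have : ∀ᶠ x in nhds n, ∀ w ∈ W, ε < inner ℝ w x := by
        rw [Filter.eventually_all_finset]
        intro w hw
        have hc : Continuous fun x : Euc d => inner ℝ w x := by fun_prop
        exact (hc.tendsto n).eventually (lt_mem_nhds (hεW w hw))
      exact this
    · intro x hx
      exact ⟨W, fun w hw => ⟨(hx w hw).le,
        Finset.single_le_sum (f := fun w : Euc d => ‖w‖) (fun _ _ => norm_nonneg _) hw⟩, hd⟩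

lemma grow {d : ℕ} (m : Euc d → ℤ) (ε : ℝ) (hε : 0 < ε) (L : ℝ) (hL : 0 ≤ L)
    (h : ∀ n ∈ Metric.sphere (0 : Euc d) 1, ∃ W : Finset (Euc d),
      (∀ w ∈ W, ε ≤ inner ℝ w n ∧ ‖w‖ ≤ L) ∧
      ∀ x y, (∀ w ∈ W, m (x - w) = m (y - w)) → m x = m y) (x y : Euc d)
    (hxy : ∀ z : Euc d, ‖z‖ ≤ L ^ 2 / ε + ε → m (x + z) = m (y + z)) :
    ∀ z, m (x + z) = m (y + z) := by
  have key : ∀ k : ℕ, ∀ z : Euc d, ‖z‖ ≤ L ^ 2 / ε + ε + k * (ε / 2) → m (x + z) = m (y + z) := by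
    intro k
    induction k with
    | zero => simpa using hxy
    | succ k ih =>
      intro z hz
      by_cases hz0 : ‖z‖ ≤ L ^ 2 / ε + ε
      · exact hxy z hz0
      push Not at hz0
      have hdiv : 0 ≤ L ^ 2 / ε := by positivity
      have hzpos : 0 < ‖z‖ := by linarith
      obtain ⟨W, hW, hd⟩ := h (‖z‖⁻¹ • z) (by
        rw [mem_sphere_zero_iff_norm, norm_smul, norm_inv, norm_norm, inv_mul_cancel₀ hzpos.ne'])
      refine hd _ _ fun w hw => ?_
      rw [add_sub_assoc, add_sub_assoc]
      refine ih _ ?_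
      obtain ⟨h1, h2⟩ := hW w hw
      rw [real_inner_smul_right] at h1
      have h3 : ε * ‖z‖ ≤ inner ℝ z w := by
        rw [real_inner_comm]
        rw [inv_mul_eq_div, le_div_iff₀ hzpos] at h1
        exact h1
      have h4 : ‖z - w‖ ^ 2 ≤ (‖z‖ - ε / 2) ^ 2 := by
        rw [norm_sub_sq_real]
        have h5 : ‖w‖ ^ 2 ≤ L ^ 2 := by gcongr
        have h6 : L ^ 2 ≤ ε * ‖z‖ := by
          have : L ^ 2 / ε ≤ ‖z‖ := by linarith
          rw [div_le_iff₀ hε] at this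
          linarith
        nlinarith
      have h7 : ‖z - w‖ ≤ ‖z‖ - ε / 2 := by
        refine le_of_sq_le_sq h4 ?_
        linarith
      push_cast at hz
      linarith
  intro z
  obtain ⟨k, hk⟩ := exists_nat_ge (‖z‖ / (ε / 2))
  refine key k z ?_
  rw [div_le_iff₀ (by positivity)] at hk
  have : 0 ≤ L ^ 2 / ε := by positivity
  linarith

lemma finite_reps {d : ℕ} (m : Euc d → ℤ) (hfin : (Set.range m).Finite)
    (hflc : SetLocallyFinite (Function.support m - Function.support m)) (R : ℝ)
    (hR : ∀ x y : Euc d, (∀ z : Euc d, ‖z‖ ≤ R → m (x + z) = m (y + z)) →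
      ∀ z, m (x + z) = m (y + z)) :
    ∃ F : Set (Euc d), F.Finite ∧ ∀ x ∈ Function.support m, ∃ y ∈ F, ∀ u, m (u - (x - y)) = m u := by
  classical
  set D := (Function.support m - Function.support m) ∩ Metric.closedBall 0 R with hD
  have hDfin : D.Finite := hflc _ Metric.isBounded_closedBall
  have := hDfin.to_subtype
  have := hfin.to_subtype
  let p : Function.support m → (D → Set.range m) := fun x z => ⟨m (x + z), ⟨_, rfl⟩⟩
  have hp : ∀ q : Set.range p, ∃ a, p a = q := fun q => q.2
  choose r hr using hp
  refine ⟨Set.range (fun q : Set.range p => (r q : Euc d)), Set.finite_range _, ?_⟩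
  intro x hx
  refine ⟨_, ⟨⟨p ⟨x, hx⟩, ⟨_, rfl⟩⟩, rfl⟩, ?_⟩
  have hy := hr ⟨p ⟨x, hx⟩, ⟨_, rfl⟩⟩
  dsimp only
  set y := r ⟨p ⟨x, hx⟩, ⟨_, rfl⟩⟩
  have hall : ∀ z, m (x + z) = m (y + z) := by
    refine hR x y fun z hz => ?_
    by_cases hzD : z ∈ D
    · have := congrFun hy ⟨z, hzD⟩
      have := congrArg Subtype.val this
      exact this.symm
    · have hz' : ∀ a ∈ Function.support m, m (a + z) = 0 := by
        intro a ha
        by_contra hne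
        exact hzD ⟨⟨a + z, hne, a, ha, by simp⟩, by simpa using hz⟩
      rw [hz' x hx, hz' y y.2]
  intro u
  have := hall (u - x)
  rw [show x + (u - x) = u by abel] at this
  rw [this]
  congr 1
  abel

lemma periods_span {d : ℕ} (Λ F P : Set (Euc d)) (hF : F.Finite) (hΛ : RelativelyDense Λ)
    (h : ∀ x ∈ Λ, ∃ y ∈ F, x - y ∈ P) : Submodule.span ℝ P = ⊤ := by
  rw [← Submodule.orthogonal_eq_bot_iff, Submodule.eq_bot_iff]
  intro n hn
  by_contra hn0
  obtain ⟨R, hR, hdense⟩ := hΛ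
  obtain ⟨B, hB⟩ := (hF.image (fun y => inner ℝ y n)).bddAbove
  have hnpos : 0 < ‖n‖ := norm_pos_iff.2 hn0
  obtain ⟨a, haΛ, ha⟩ := hdense (((B + R * ‖n‖ + 1) / ‖n‖ ^ 2) • n)
  obtain ⟨y, hy, hP⟩ := h a haΛ
  have h1 : inner ℝ (a - y) n = 0 := (Submodule.mem_orthogonal _ _).1 hn _ (Submodule.subset_span hP)
  rw [inner_sub_left] at h1
  have h2 : inner ℝ y n ≤ B := hB ⟨y, hy, rfl⟩
  set s := ((B + R * ‖n‖ + 1) / ‖n‖ ^ 2) • n with hs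
  have h3 : inner ℝ s n = B + R * ‖n‖ + 1 := by
    rw [hs, real_inner_smul_left, real_inner_self_eq_norm_sq]
    field_simp
  have h4 : inner ℝ (s - a) n ≤ R * ‖n‖ := by
    refine (real_inner_le_norm _ _).trans ?_
    gcongr
    rw [← dist_eq_norm, dist_comm]
    exact ha
  rw [inner_sub_left] at h4
  linarith

theorem stmt_5 (d : ℕ) (hd : 0 < d) (c : Euc d → ℂ)
    (hfin : (Set.range c).Finite) (hint : ∀ u, ∃ n : ℤ, c u = (n : ℂ))
    (hsupp : DeloneFLC (Function.support c))
    (hV : ∀ V : Submodule ℝ (Euc d), Module.finrank ℝ V = d - 1 →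
      ∃ f : Euc d → ℂ, (Function.support f).Finite ∧ f ≠ 0 ∧ Annihilates f c ∧
        Function.support f ∩ (V : Set (Euc d)) = {0}) :
    StronglyPeriodic c := by
  choose m hm using hint
  have hcm : c = fun u => (m u : ℂ) := funext hm
  have hsup : Function.support m = Function.support c := by
    ext u
    simp [hm]
  have hmfin : (Set.range m).Finite := by
    refine Set.Finite.of_finite_image (f := (Int.cast : ℤ → ℂ)) ?_ Int.cast_injective.injOn
    rw [← Set.range_comp]
    convert hfin using 2
    exact hcm.symm
  obtain ⟨K, hK⟩ : ∃ K : ℤ, ∀ u, |m u| ≤ K := by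
    obtain ⟨K, hK⟩ := (hmfin.image (fun z => |z|)).bddAbove
    exact ⟨K, fun u => hK ⟨m u, ⟨u, rfl⟩, rfl⟩⟩
  have hdet : ∀ n : Euc d, n ≠ 0 → ∃ W : Finset (Euc d), (∀ w ∈ W, 0 < inner ℝ w n) ∧
      ∀ x y, (∀ w ∈ W, m (x - w) = m (y - w)) → m x = m y := by
    intro n hn
    have : Fact (Module.finrank ℝ (Euc d) = (d - 1) + 1) :=
      ⟨by rw [finrank_euclideanSpace_fin]; omega⟩
    obtain ⟨f, hf1, -, hf3, hf4⟩ := hV (ℝ ∙ n)ᗮ (Submodule.finrank_orthogonal_span_singleton hn)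
    rw [hcm] at hf3
    refine det_dir m K hK n f hf1 hf3 ?_
    rw [← hf4]
    congr 1
    ext x
    simp [Submodule.mem_orthogonal_singleton_iff_inner_left]
  obtain ⟨ε, hε, L, hL, H⟩ := unif_det m hdet
  obtain ⟨⟨-, hdense⟩, hflc⟩ := hsupp
  rw [← hsup] at hdense hflc
  obtain ⟨F, hF, hFx⟩ := finite_reps m hmfin hflc _ (grow m ε hε L hL H)
  have hspan := periods_span _ F {t | ∀ u, m (u - t) = m u} hF hdense hFx
  obtain ⟨t, ht, -, hli⟩ := Submodule.exists_fun_fin_finrank_span_eq ℝ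
    {t : Euc d | ∀ u, m (u - t) = m u}
  have hfr : Module.finrank ℝ (Submodule.span ℝ {t : Euc d | ∀ u, m (u - t) = m u}) = d := by
    rw [hspan, finrank_top, finrank_euclideanSpace_fin]
  refine ⟨fun i => t (Fin.cast hfr.symm i), hli.comp _ (Fin.cast_injective _), ?_⟩
  intro i u
  rw [hm, hm, ht]

end
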